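/- Let i ∈ {1,2}. There is an absolute constant C such that for all ν ≥ 0, T > 0, k = (k₁,k₂) ∈ ℤ², and all u₀ ∈ L¹(ℝ²) whose Fourier transform is supported in {ξ : |ξ₁-k₁| ≤ 1, |ξ₂-k₂| ≤ 1}, one has ( ∫_ℝ ( sup_{0 ≤ t ≤ T, x_j ∈ ℝ (j ≠ i)} |(G_ν(t)u₀)(x)| )² dx_i )^{1/2} ≤ C (1+|k_i|)^{1/2} ‖u₀‖_{L¹(ℝ²)}. -/

import Mathlib

open MeasureTheory

noncomputable section

/-- `e r = exp (i r)`. -/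
def e (r : ℝ) : ℂ := Complex.exp (Complex.I * (r : ℂ))

/-- Insert the value `a` in the `i`-th coordinate of `y` to get a point of `ℝ²`. -/
def embed {n : ℕ} (i : Fin n) (a : ℝ) (y : {j : Fin n // j ≠ i} → ℝ) : Fin n → ℝ :=
  fun j => if h : j = i then a else y ⟨j, h⟩

/-- The Fourier transform: `𝓕 f (ξ) = ∫ e^{-ix·ξ} f x dx`. -/
def FT {n : ℕ} (f : (Fin n → ℝ) → ℂ) (ξ : Fin n → ℝ) : ℂ :=
  ∫ x : Fin n → ℝ, e (-(∑ j, x j * ξ j)) * f x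

/-- The Ginzburg–Landau semigroup `G_ν(t) f = 𝓕⁻¹(e^{-it|ξ|² - νt|ξ|²} 𝓕f)`. -/
def Gnu {n : ℕ} (ν : ℝ) (f : (Fin n → ℝ) → ℂ) (t : ℝ) (x : Fin n → ℝ) : ℂ :=
  ((2 * Real.pi) ^ n)⁻¹ •
    ∫ ξ : Fin n → ℝ,
      e ((∑ j, x j * ξ j) - t * (∑ j, ξ j ^ 2)) *
        (Real.exp (-(ν * t * (∑ j, ξ j ^ 2))) : ℂ) * FT f ξ

lemma norm_e (r : ℝ) : ‖e r‖ = 1 := by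
  unfold e
  rw [mul_comm]
  exact Complex.norm_exp_ofReal_mul_I r

lemma continuous_e : Continuous e := by
  unfold e
  fun_prop

lemma hasDerivAt_e_quadratic (a t ξ : ℝ) :
    HasDerivAt (fun x : ℝ => e (a * x - t * x ^ 2))
      (e (a * ξ - t * ξ ^ 2) * (Complex.I * ((a - 2 * t * ξ : ℝ) : ℂ))) ξ := by
  have h : HasDerivAt (fun x : ℝ => a * x - t * x ^ 2) (a - 2 * t * ξ) ξ := by
    have := ((hasDerivAt_id ξ).const_mul a).sub (((hasDerivAt_id ξ).pow 2).const_mul t)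
    refine this.congr_deriv ?_
    simp
    ring
  exact (h.ofReal_comp.const_mul Complex.I).cexp

/-- First-derivative test for a quadratic phase whose derivative is bounded below. -/
lemma norm_integral_e_quadratic_le_of_le_deriv {a t lam p q : ℝ} (ht : 0 ≤ t) (hlam : 0 < lam)
    (hpq : p ≤ q) (h : ∀ ξ ∈ Set.Icc p q, lam ≤ a - 2 * t * ξ) :
    ‖∫ ξ in p..q, e (a * ξ - t * ξ ^ 2)‖ ≤ 3 / lam := by
  have hu : Set.uIcc p q = Set.Icc p q := Set.uIcc_of_le hpq
  have hpos : ∀ ξ ∈ Set.Icc p q, 0 < a - 2 * t * ξ := fun ξ hξ => hlam.trans_le (h ξ hξ)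
  have hinv : ∀ ξ ∈ Set.uIcc p q, HasDerivAt (fun x : ℝ => (a - 2 * t * x)⁻¹)
      (2 * t / (a - 2 * t * ξ) ^ 2) ξ := by
    intro ξ hξ
    rw [hu] at hξ
    have h1 : HasDerivAt (fun x : ℝ => a - 2 * t * x) (-(2 * t)) ξ := by
      simpa using ((hasDerivAt_id ξ).const_mul (2 * t)).const_sub a
    simpa using h1.fun_inv (hpos ξ hξ).ne'
  have hcont : ContinuousOn (fun ξ : ℝ => 2 * t / (a - 2 * t * ξ) ^ 2) (Set.uIcc p q) := by
    refine ContinuousOn.div (by fun_prop) (by fun_prop) fun ξ hξ => ?_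
    rw [hu] at hξ
    exact pow_ne_zero 2 (hpos ξ hξ).ne'
  have hE : Continuous fun ξ : ℝ => e (a * ξ - t * ξ ^ 2) := continuous_e.comp (by fun_prop)
  have hparts := intervalIntegral.integral_mul_deriv_eq_deriv_mul
    (u := fun x : ℝ => (((a - 2 * t * x)⁻¹ : ℝ) : ℂ)) (v := fun x : ℝ => e (a * x - t * x ^ 2))
    (fun ξ hξ => (hinv ξ hξ).ofReal_comp) (fun ξ _ => hasDerivAt_e_quadratic a t ξ)
    ((Complex.continuous_ofReal.comp_continuousOn hcont).intervalIntegrable)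
    ((hE.mul (by fun_prop)).intervalIntegrable p q)
  have hlhs : ∫ ξ in p..q, (((a - 2 * t * ξ)⁻¹ : ℝ) : ℂ) *
      (e (a * ξ - t * ξ ^ 2) * (Complex.I * ((a - 2 * t * ξ : ℝ) : ℂ))) =
      Complex.I * ∫ ξ in p..q, e (a * ξ - t * ξ ^ 2) := by
    rw [← intervalIntegral.integral_const_mul]
    refine intervalIntegral.integral_congr fun ξ hξ => ?_
    rw [hu] at hξ
    have h0 : ((a - 2 * t * ξ : ℝ) : ℂ) ≠ 0 := by exact_mod_cast (hpos ξ hξ).ne'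
    simp only [Complex.ofReal_inv]
    field_simp
  have hrem : ‖∫ ξ in p..q, ((2 * t / (a - 2 * t * ξ) ^ 2 : ℝ) : ℂ) * e (a * ξ - t * ξ ^ 2)‖ ≤
      (a - 2 * t * q)⁻¹ - (a - 2 * t * p)⁻¹ := by
    rw [← intervalIntegral.integral_eq_sub_of_hasDerivAt hinv hcont.intervalIntegrable]
    refine intervalIntegral.norm_integral_le_of_norm_le hpq (Filter.Eventually.of_forall ?_)
      hcont.intervalIntegrable
    intro ξ _
    rw [norm_mul, norm_e, mul_one, Complex.norm_real, Real.norm_of_nonneg (by positivity)]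
  have hp := h p ⟨le_rfl, hpq⟩
  have hq := h q ⟨hpq, le_rfl⟩
  have hp' : 0 < (a - 2 * t * p)⁻¹ := inv_pos.2 (hlam.trans_le hp)
  have hq' : 0 < (a - 2 * t * q)⁻¹ := inv_pos.2 (hlam.trans_le hq)
  have hq2 : (a - 2 * t * q)⁻¹ ≤ lam⁻¹ := inv_anti₀ hlam hq
  have hp2 : (a - 2 * t * p)⁻¹ ≤ lam⁻¹ := inv_anti₀ hlam hp
  have hnorm : ∀ x r : ℝ, 0 < x → ‖((x : ℝ) : ℂ) * e r‖ = x := fun x r hx => by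
    rw [norm_mul, norm_e, mul_one, Complex.norm_real, Real.norm_of_nonneg hx.le]
  have hmain : ‖∫ ξ in p..q, e (a * ξ - t * ξ ^ 2)‖ =
      ‖Complex.I * ∫ ξ in p..q, e (a * ξ - t * ξ ^ 2)‖ := by simp
  rw [hmain, ← hlhs, hparts]
  calc _ ≤ (a - 2 * t * q)⁻¹ + (a - 2 * t * p)⁻¹ +
        ((a - 2 * t * q)⁻¹ - (a - 2 * t * p)⁻¹) := by
        refine (norm_sub_le _ _).trans (add_le_add ((norm_sub_le _ _).trans ?_) hrem)
        rw [hnorm _ _ hp', hnorm _ _ hq']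
    _ ≤ 3 / lam := by rw [div_eq_mul_inv]; linarith

/-- First-derivative test for a quadratic phase whose derivative is bounded above. -/
lemma norm_integral_e_quadratic_le_of_deriv_le {a t lam p q : ℝ} (ht : 0 ≤ t) (hlam : 0 < lam)
    (hpq : p ≤ q) (h : ∀ ξ ∈ Set.Icc p q, a - 2 * t * ξ ≤ -lam) :
    ‖∫ ξ in p..q, e (a * ξ - t * ξ ^ 2)‖ ≤ 3 / lam := by
  have h1 : ∫ ξ in p..q, e (a * ξ - t * ξ ^ 2) =
      ∫ ξ in -q..-p, e ((-a) * ξ - t * ξ ^ 2) := by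
    rw [← intervalIntegral.integral_comp_neg]
    simp
  rw [h1]
  refine norm_integral_e_quadratic_le_of_le_deriv ht hlam (neg_le_neg hpq) fun ξ hξ => ?_
  have := h (-ξ) ⟨by linarith [hξ.2], by linarith [hξ.1]⟩
  linarith

lemma norm_integral_e_le_sub (φ : ℝ → ℝ) {p q : ℝ} (hpq : p ≤ q) :
    ‖∫ ξ in p..q, e (φ ξ)‖ ≤ q - p := by
  have := intervalIntegral.norm_integral_le_of_norm_le_const (a := p) (b := q) (C := 1)
    (f := fun ξ => e (φ ξ)) fun ξ _ => (norm_e _).le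
  rwa [one_mul, abs_of_nonneg (sub_nonneg.2 hpq)] at this

/-- Second-derivative test for a quadratic phase. -/
lemma norm_integral_e_quadratic_le_div_sqrt (a : ℝ) {t p q : ℝ} (ht : 0 < t) (hpq : p ≤ q) :
    ‖∫ ξ in p..q, e (a * ξ - t * ξ ^ 2)‖ ≤ 5 / √t := by
  have hs : 0 < √t := Real.sqrt_pos.2 ht
  have hst : √t * √t = t := Real.mul_self_sqrt ht.le
  obtain ⟨c, hc⟩ : ∃ c, a = 2 * t * c := ⟨a / (2 * t), by field_simp⟩
  obtain ⟨d, hd⟩ : ∃ d, d = 1 / √t := ⟨_, rfl⟩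
  have hd0 : 0 < d := by rw [hd]; positivity
  have htd : t * d = √t := by rw [hd]; field_simp; nlinarith
  obtain ⟨p', hp'⟩ : ∃ x, x = max p (min q (c - d)) := ⟨_, rfl⟩
  obtain ⟨q', hq'⟩ : ∃ x, x = max p' (min q (c + d)) := ⟨_, rfl⟩
  have hpp' : p ≤ p' := hp' ▸ le_max_left _ _
  have hpq' : p' ≤ q' := hq' ▸ le_max_left _ _
  have hp'q : p' ≤ q := by rw [hp']; exact max_le hpq (min_le_left _ _)
  have hq'q : q' ≤ q := by rw [hq']; exact max_le hp'q (min_le_left _ _)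
  have hint : ∀ x y : ℝ, IntervalIntegrable (fun ξ => e (a * ξ - t * ξ ^ 2)) volume x y :=
    fun x y => (continuous_e.comp (by fun_prop)).intervalIntegrable x y
  have hleft : ‖∫ ξ in p..p', e (a * ξ - t * ξ ^ 2)‖ ≤ 3 / (2 * √t) := by
    rcases hpp'.eq_or_lt with heq | hlt
    · rw [← heq, intervalIntegral.integral_same, norm_zero]
      positivity
    · refine norm_integral_e_quadratic_le_of_le_deriv ht.le (by positivity) hpp' fun ξ hξ => ?_
      have : p' ≤ c - d := by
        rcases max_choice p (min q (c - d)) with hm | hm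
        · rw [hm] at hp'; linarith
        · rw [hm] at hp'; exact hp' ▸ min_le_right _ _
      nlinarith [mul_le_mul_of_nonneg_left (hξ.2.trans this) ht.le]
  have hright : ‖∫ ξ in q'..q, e (a * ξ - t * ξ ^ 2)‖ ≤ 3 / (2 * √t) := by
    rcases hq'q.eq_or_lt with heq | hlt
    · rw [← heq, intervalIntegral.integral_same, norm_zero]
      positivity
    · refine norm_integral_e_quadratic_le_of_deriv_le ht.le (by positivity) hq'q fun ξ hξ => ?_
      have : c + d ≤ q' := by
        have h1 : min q (c + d) ≤ q' := hq' ▸ le_max_right _ _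
        rcases min_le_iff.1 h1 with h2 | h2
        · linarith
        · exact h2
      nlinarith [mul_le_mul_of_nonneg_left (this.trans hξ.1) ht.le]
  have hmid : ‖∫ ξ in p'..q', e (a * ξ - t * ξ ^ 2)‖ ≤ 2 * d := by
    refine (norm_integral_e_le_sub _ hpq').trans ?_
    rcases max_choice p' (min q (c + d)) with hm | hm
    · rw [hm] at hq'; linarith
    · rw [hm] at hq'
      have h1 : q' ≤ c + d := hq' ▸ min_le_right _ _
      have h2 : q' ≤ q := hq'q
      have h3 : min q (c - d) ≤ p' := hp' ▸ le_max_right _ _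
      rcases min_le_iff.1 h3 with h4 | h4 <;> linarith
  rw [← intervalIntegral.integral_add_adjacent_intervals (hint p q') (hint q' q),
    ← intervalIntegral.integral_add_adjacent_intervals (hint p p') (hint p' q')]
  calc _ ≤ 3 / (2 * √t) + 2 * d + 3 / (2 * √t) :=
        (norm_add_le _ _).trans (add_le_add ((norm_add_le _ _).trans (add_le_add hleft hmid)) hright)
    _ = 5 / √t := by rw [hd]; field_simp; norm_num

/-- A Gaussian weight on an interval that does not cross the origin costs at most a factor `2`. -/
lemma norm_integral_mul_gaussian_le {f : ℝ → ℂ} (hf : Continuous f) {s p q B : ℝ} (hs : 0 ≤ s)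
    (hpq : p ≤ q) (hsign : 0 ≤ p ∨ q ≤ 0) (hB : ∀ r ∈ Set.Icc p q, ‖∫ ξ in p..r, f ξ‖ ≤ B) :
    ‖∫ ξ in p..q, f ξ * (Real.exp (-(s * ξ ^ 2)) : ℂ)‖ ≤ 2 * B := by
  have hB0 : 0 ≤ B := (norm_nonneg _).trans (hB p ⟨le_rfl, hpq⟩)
  have hw : ∀ ξ : ℝ, HasDerivAt (fun x : ℝ => Real.exp (-(s * x ^ 2)))
      (-(2 * s * ξ) * Real.exp (-(s * ξ ^ 2))) ξ := by
    intro ξ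
    have h : HasDerivAt (fun x : ℝ => -(s * x ^ 2)) (-(2 * s * ξ)) ξ := by
      refine (((hasDerivAt_id ξ).pow 2).const_mul s).neg.congr_deriv ?_
      simp
      ring
    exact h.exp.congr_deriv (mul_comm _ _)
  have hw'c : Continuous fun ξ : ℝ => -(2 * s * ξ) * Real.exp (-(s * ξ ^ 2)) := by fun_prop
  have hF : ∀ ξ : ℝ, HasDerivAt (fun x : ℝ => ∫ y in p..x, f y) (f ξ) ξ := fun ξ =>
    intervalIntegral.integral_hasDerivAt_right (hf.intervalIntegrable _ _)
      hf.stronglyMeasurable.stronglyMeasurableAtFilter hf.continuousAt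
  have hparts := intervalIntegral.integral_mul_deriv_eq_deriv_mul (a := p) (b := q)
    (u := fun x : ℝ => ((Real.exp (-(s * x ^ 2)) : ℝ) : ℂ)) (v := fun x : ℝ => ∫ y in p..x, f y)
    (fun ξ _ => (hw ξ).ofReal_comp) (fun ξ _ => hF ξ)
    ((Complex.continuous_ofReal.comp hw'c).intervalIntegrable p q) (hf.intervalIntegrable p q)
  have hwle : ∀ ξ : ℝ, Real.exp (-(s * ξ ^ 2)) ≤ 1 := fun ξ =>
    Real.exp_le_one_iff.2 (neg_nonpos.2 (by positivity))
  have hvar : ∫ ξ in p..q, |-(2 * s * ξ) * Real.exp (-(s * ξ ^ 2))| ≤ 1 := by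
    have hftc := intervalIntegral.integral_eq_sub_of_hasDerivAt (a := p) (b := q)
      (fun ξ _ => hw ξ) (hw'c.intervalIntegrable p q)
    rcases hsign with h0 | h0
    · have : ∫ ξ in p..q, |-(2 * s * ξ) * Real.exp (-(s * ξ ^ 2))| =
          ∫ ξ in p..q, -(-(2 * s * ξ) * Real.exp (-(s * ξ ^ 2))) := by
        refine intervalIntegral.integral_congr fun ξ hξ => ?_
        rw [Set.uIcc_of_le hpq] at hξ
        have : 0 ≤ ξ := h0.trans hξ.1
        refine abs_of_nonpos ?_
        rw [neg_mul]
        exact neg_nonpos.2 (by positivity)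
      rw [this, intervalIntegral.integral_neg, hftc]
      linarith [hwle p, Real.exp_pos (-(s * q ^ 2))]
    · have : ∫ ξ in p..q, |-(2 * s * ξ) * Real.exp (-(s * ξ ^ 2))| =
          ∫ ξ in p..q, -(2 * s * ξ) * Real.exp (-(s * ξ ^ 2)) := by
        refine intervalIntegral.integral_congr fun ξ hξ => ?_
        rw [Set.uIcc_of_le hpq] at hξ
        have : 0 ≤ -ξ := by linarith [hξ.2]
        refine abs_of_nonneg (mul_nonneg ?_ (Real.exp_pos _).le)
        nlinarith
      rw [this, hftc]
      linarith [hwle q, Real.exp_pos (-(s * p ^ 2))]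
  have hrem : ‖∫ ξ in p..q, ((-(2 * s * ξ) * Real.exp (-(s * ξ ^ 2)) : ℝ) : ℂ) *
      ∫ y in p..ξ, f y‖ ≤ B := by
    calc _ ≤ ∫ ξ in p..q, |-(2 * s * ξ) * Real.exp (-(s * ξ ^ 2))| * B := by
          refine intervalIntegral.norm_integral_le_of_norm_le hpq
            (Filter.Eventually.of_forall fun ξ hξ => ?_)
            ((hw'c.abs.mul continuous_const).intervalIntegrable p q)
          rw [norm_mul, Complex.norm_real, Real.norm_eq_abs]
          exact mul_le_mul_of_nonneg_left (hB ξ ⟨hξ.1.le, hξ.2⟩) (abs_nonneg _)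
      _ = (∫ ξ in p..q, |-(2 * s * ξ) * Real.exp (-(s * ξ ^ 2))|) * B :=
          intervalIntegral.integral_mul_const _ _
      _ ≤ B := by nlinarith
  have hcomm : ∫ ξ in p..q, f ξ * (Real.exp (-(s * ξ ^ 2)) : ℂ) =
      ∫ ξ in p..q, (Real.exp (-(s * ξ ^ 2)) : ℂ) * f ξ := by simp only [mul_comm]
  rw [hcomm, hparts, intervalIntegral.integral_same, mul_zero, sub_zero]
  refine (norm_sub_le _ _).trans ?_
  have hbd : ‖((Real.exp (-(s * q ^ 2)) : ℝ) : ℂ) * ∫ y in p..q, f y‖ ≤ B := by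
    rw [norm_mul, Complex.norm_real, Real.norm_of_nonneg (Real.exp_pos _).le]
    have := hB q ⟨hpq, le_rfl⟩
    nlinarith [hwle q, Real.exp_pos (-(s * q ^ 2)), norm_nonneg (∫ y in p..q, f y)]
  linarith

/-- The one-dimensional kernel `∫ e^{i(aξ - tξ²) - sξ²} dξ` over the unit interval around `κ`. -/
def oscKernel (κ s t a : ℝ) : ℂ :=
  ∫ ξ in (κ - 1)..(κ + 1), e (a * ξ - t * ξ ^ 2) * (Real.exp (-(s * ξ ^ 2)) : ℂ)

lemma continuous_e_mul_gaussian (a t s : ℝ) :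
    Continuous fun ξ : ℝ => e (a * ξ - t * ξ ^ 2) * (Real.exp (-(s * ξ ^ 2)) : ℂ) :=
  (continuous_e.comp (by fun_prop)).mul (by fun_prop)

lemma norm_oscKernel_le_two (κ t a : ℝ) {s : ℝ} (hs : 0 ≤ s) : ‖oscKernel κ s t a‖ ≤ 2 := by
  have := intervalIntegral.norm_integral_le_of_norm_le_const (a := κ - 1) (b := κ + 1) (C := 1)
    (f := fun ξ : ℝ => e (a * ξ - t * ξ ^ 2) * (Real.exp (-(s * ξ ^ 2)) : ℂ)) fun ξ _ => by
      rw [norm_mul, norm_e, one_mul, Complex.norm_real, Real.norm_of_nonneg (Real.exp_pos _).le]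
      exact Real.exp_le_one_iff.2 (neg_nonpos.2 (by positivity))
  refine this.trans_eq ?_
  norm_num

lemma norm_oscKernel_le (k : ℤ) {s t a B : ℝ} (hs : 0 ≤ s)
    (hB : ∀ p q : ℝ, (k : ℝ) - 1 ≤ p → p ≤ q → q ≤ k + 1 →
      ‖∫ ξ in p..q, e (a * ξ - t * ξ ^ 2)‖ ≤ B) :
    ‖oscKernel k s t a‖ ≤ 4 * B := by
  have hf : Continuous fun ξ : ℝ => e (a * ξ - t * ξ ^ 2) := continuous_e.comp (by fun_prop)
  have hint := fun x y => (continuous_e_mul_gaussian a t s).intervalIntegrable (μ := volume) x y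
  have hsign : ∀ m : ℤ, (0 : ℝ) ≤ m ∨ (m : ℝ) + 1 ≤ 0 := fun m => by
    rcases le_or_gt 0 m with h | h
    · exact Or.inl (by exact_mod_cast h)
    · exact Or.inr (by exact_mod_cast h)
  unfold oscKernel
  rw [← intervalIntegral.integral_add_adjacent_intervals (hint _ (k : ℝ)) (hint _ _)]
  have h1 := norm_integral_mul_gaussian_le hf hs (show (k : ℝ) - 1 ≤ k by linarith)
    (by simpa using hsign (k - 1)) fun r hr => hB _ r le_rfl hr.1 (by linarith [hr.2])
  have h2 := norm_integral_mul_gaussian_le hf hs (show (k : ℝ) ≤ k + 1 by linarith)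
    (hsign k) fun r hr => hB _ r (by linarith) hr.1 hr.2
  refine (norm_add_le _ _).trans ?_
  linarith

lemma norm_oscKernel_le_div_sqrt (k : ℤ) (a : ℝ) {s t : ℝ} (hs : 0 ≤ s) (ht : 0 < t) :
    ‖oscKernel k s t a‖ ≤ 20 / √t := by
  refine (norm_oscKernel_le k hs fun p q _ hpq _ =>
    norm_integral_e_quadratic_le_div_sqrt a ht hpq).trans_eq ?_
  ring

lemma norm_oscKernel_le_div_abs (k : ℤ) {s t a : ℝ} (hs : 0 ≤ s) (ht : 0 ≤ t) (ha : a ≠ 0)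
    (hta : 4 * t * (1 + |(k : ℝ)|) ≤ |a|) :
    ‖oscKernel k s t a‖ ≤ 24 / |a| := by
  have ha' : 0 < |a| := abs_pos.2 ha
  have hsmall : ∀ p q ξ : ℝ, (k : ℝ) - 1 ≤ p → q ≤ k + 1 → ξ ∈ Set.Icc p q →
      |2 * t * ξ| ≤ |a| / 2 := by
    intro p q ξ hp hq hξ
    have : |ξ| ≤ 1 + |(k : ℝ)| := by
      rw [abs_le]
      constructor <;> linarith [hξ.1, hξ.2, le_abs_self (k : ℝ), neg_abs_le (k : ℝ)]
    rw [abs_mul, abs_of_nonneg (by positivity : 0 ≤ 2 * t)]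
    nlinarith
  have key := norm_oscKernel_le k (s := s) (t := t) (a := a) (B := 3 / (|a| / 2)) hs
    fun p q hp hpq hq => by
      rcases le_or_gt 0 a with h0 | h0
      · refine norm_integral_e_quadratic_le_of_le_deriv ht (by positivity) hpq fun ξ hξ => ?_
        have := (abs_le.1 (hsmall p q ξ hp hq hξ)).2
        rw [abs_of_nonneg h0] at this ⊢
        linarith
      · refine norm_integral_e_quadratic_le_of_deriv_le ht (by positivity) hpq fun ξ hξ => ?_
        have := (abs_le.1 (hsmall p q ξ hp hq hξ)).1
        rw [abs_of_neg h0] at this ⊢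
        linarith
  refine key.trans_eq ?_
  field_simp
  norm_num

/-- The product of two one-dimensional kernels, maximised over time and over the second
variable, decays like `(1 + |k|) / |a|` in the first variable. -/
lemma norm_oscKernel_mul_sq_le (k l : ℤ) (a b : ℝ) {s t : ℝ} (hs : 0 ≤ s) (ht : 0 ≤ t) :
    (‖oscKernel k s t a‖ * ‖oscKernel l s t b‖) ^ 2 ≤
      2560016 * (1 + (a / (1 + |(k : ℝ)|)) ^ 2)⁻¹ := by
  obtain ⟨L, hL⟩ : ∃ L, L = 1 + |(k : ℝ)| := ⟨_, rfl⟩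
  have hL1 : 1 ≤ L := by rw [hL]; linarith [abs_nonneg (k : ℝ)]
  obtain ⟨P, hP⟩ : ∃ P, P = ‖oscKernel k s t a‖ * ‖oscKernel l s t b‖ := ⟨_, rfl⟩
  have hP0 : 0 ≤ P := by rw [hP]; positivity
  have hk2 := norm_oscKernel_le_two k t a hs
  have hl2 := norm_oscKernel_le_two l t b hs
  have hP4 : P ≤ 4 := by
    rw [hP]
    nlinarith [norm_nonneg (oscKernel k s t a), norm_nonneg (oscKernel l s t b)]
  have hPa : P * |a| ≤ 1600 * L := by
    rcases eq_or_ne a 0 with rfl | ha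
    · simp only [abs_zero, mul_zero]; linarith
    have ha' : 0 < |a| := abs_pos.2 ha
    rcases le_or_gt (4 * t * L) |a| with h | h
    · have h1 := norm_oscKernel_le_div_abs k hs ht ha (hL ▸ h)
      have h2 : P ≤ 24 / |a| * 2 := by rw [hP]; gcongr
      calc P * |a| ≤ 24 / |a| * 2 * |a| := by gcongr
        _ = 48 := by field_simp; norm_num
        _ ≤ 1600 * L := by linarith
    · have ht' : 0 < t := by
        rcases ht.eq_or_lt with h0 | h0
        · rw [← h0] at h; simp only [mul_zero, zero_mul] at h; linarith
        · exact h0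
      have h2 : P ≤ 20 / √t * (20 / √t) := by
        rw [hP]
        exact mul_le_mul (norm_oscKernel_le_div_sqrt k a hs ht')
          (norm_oscKernel_le_div_sqrt l b hs ht') (norm_nonneg _) (by positivity)
      have h3 : 20 / √t * (20 / √t) = 400 / t := by
        rw [div_mul_div_comm, Real.mul_self_sqrt ht]
        norm_num
      rw [h3] at h2
      calc P * |a| ≤ 400 / t * (4 * t * L) := by gcongr
        _ = 1600 * L := by field_simp; norm_num
  rw [← hP, ← hL, ← div_eq_mul_inv, le_div_iff₀ (by positivity)]
  have h5 : P * (|a| / L) ≤ 1600 := by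
    rw [← mul_div_assoc, div_le_iff₀ (by linarith)]
    exact hPa
  have h6 : (P * (|a| / L)) ^ 2 ≤ 1600 ^ 2 := by gcongr
  have h7 : P ^ 2 ≤ 4 ^ 2 := by gcongr
  rw [mul_pow, div_pow, sq_abs] at h6
  rw [div_pow]
  linarith

/-- Integration over a box of a product of functions of the coordinates. -/
lemma setIntegral_pi_prod {n : ℕ} (s : Fin n → Set ℝ) (f : Fin n → ℝ → ℂ) :
    ∫ ξ in Set.univ.pi s, ∏ j, f j (ξ j) = ∏ j, ∫ x in s j, f j x := by
  rw [volume_pi, Measure.restrict_pi_pi]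
  exact integral_fintype_prod_eq_prod f

lemma Gnu_eq_integral_oscKernel {n : ℕ} {ν t : ℝ} (hν : 0 ≤ ν) (ht : 0 ≤ t) (k : Fin n → ℤ)
    {u : (Fin n → ℝ) → ℂ} (hu : Integrable u)
    (hsupp : ∀ ξ : Fin n → ℝ, (∃ j, 1 < |ξ j - (k j : ℝ)|) → FT u ξ = 0) (x : Fin n → ℝ) :
    Gnu ν u t x = ((2 * Real.pi) ^ n)⁻¹ •
      ∫ y : Fin n → ℝ, (∏ j, oscKernel (k j) (ν * t) t (x j - y j)) * u y := by
  set s : Fin n → Set ℝ := fun j => Set.Icc ((k j : ℝ) - 1) (k j + 1) with hs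
  set A : (Fin n → ℝ) → ℂ := fun ξ => e ((∑ j, x j * ξ j) - t * (∑ j, ξ j ^ 2)) *
        (Real.exp (-(ν * t * (∑ j, ξ j ^ 2))) : ℂ) with hA
  have hAc : Continuous A := (continuous_e.comp (by fun_prop)).mul (by fun_prop)
  have hA1 : ∀ ξ, ‖A ξ‖ ≤ 1 := fun ξ => by
    simp only [hA]
    rw [norm_mul, norm_e, one_mul, Complex.norm_real, Real.norm_of_nonneg (Real.exp_pos _).le]
    exact Real.exp_le_one_iff.2 (neg_nonpos.2 (by positivity))
  have hprod : ∀ y ξ : Fin n → ℝ, A ξ * e (-(∑ j, y j * ξ j)) =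
      ∏ j, (e ((x j - y j) * ξ j - t * ξ j ^ 2) * (Real.exp (-(ν * t * ξ j ^ 2)) : ℂ)) := by
    intro y ξ
    simp only [hA, e, Complex.ofReal_exp, ← Complex.exp_add, ← Complex.exp_sum]
    congr 1
    push_cast
    simp only [sub_mul, mul_sub, Finset.sum_add_distrib, Finset.sum_sub_distrib, Finset.mul_sum,
      Finset.sum_neg_distrib, mul_neg, mul_assoc]
    ring
  unfold Gnu
  congr 1
  have hbox : ∫ ξ : Fin n → ℝ, A ξ * FT u ξ = ∫ ξ in Set.univ.pi s, A ξ * FT u ξ := by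
    refine (setIntegral_eq_integral_of_forall_compl_eq_zero fun ξ hξ => ?_).symm
    rw [hsupp ξ, mul_zero]
    simp only [hs, Set.mem_pi, Set.mem_univ, true_implies, not_forall] at hξ
    obtain ⟨j, hj⟩ := hξ
    refine ⟨j, not_le.1 fun h => hj ?_⟩
    rw [abs_le] at h
    exact ⟨by linarith, by linarith⟩
  have hfin : volume (Set.univ.pi s) ≠ ⊤ := by
    simp only [hs]
    exact (isCompact_univ_pi fun j => isCompact_Icc).measure_lt_top.ne
  have : IsFiniteMeasure (volume.restrict (Set.univ.pi s)) := ⟨by simpa using hfin.lt_top⟩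
  have hint : Integrable (Function.uncurry fun ξ y : Fin n → ℝ =>
      A ξ * (e (-(∑ j, y j * ξ j)) * u y)) ((volume.restrict (Set.univ.pi s)).prod volume) := by
    have h1 : Integrable (fun z : (Fin n → ℝ) × (Fin n → ℝ) => u z.2)
        ((volume.restrict (Set.univ.pi s)).prod volume) := hu.comp_snd _
    have hc : Continuous fun z : (Fin n → ℝ) × (Fin n → ℝ) =>
        A z.1 * e (-(∑ j, z.2 j * z.1 j)) :=
      (hAc.comp continuous_fst).mul (continuous_e.comp (by fun_prop))
    refine (h1.bdd_mul (c := 1) hc.aestronglyMeasurable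
      (Filter.Eventually.of_forall fun z => ?_)).congr (Filter.Eventually.of_forall fun z => ?_)
    · rw [norm_mul, norm_e, mul_one]
      exact hA1 _
    · simp only [Function.uncurry, mul_assoc]
  calc ∫ ξ : Fin n → ℝ, A ξ * FT u ξ
      = ∫ ξ in Set.univ.pi s, ∫ y, A ξ * (e (-(∑ j, y j * ξ j)) * u y) := by
        rw [hbox]
        simp only [FT, integral_const_mul]
    _ = ∫ y, ∫ ξ in Set.univ.pi s, A ξ * (e (-(∑ j, y j * ξ j)) * u y) := integral_integral_swap hint
    _ = _ := by
        congr 1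
        ext y
        simp only [← mul_assoc, hprod]
        rw [integral_mul_const, setIntegral_pi_prod s fun j ξ =>
          e ((x j - y j) * ξ - t * ξ ^ 2) * (Real.exp (-(ν * t * ξ ^ 2)) : ℂ)]
        congr 1
        refine Finset.prod_congr rfl fun j _ => ?_
        rw [oscKernel, intervalIntegral.integral_of_le (by linarith), hs,
          integral_Icc_eq_integral_Ioc]

/-- Cauchy–Schwarz for the measure with density `w`. -/
lemma sq_integral_mul_le {α : Type*} [MeasurableSpace α] {μ : Measure α} {w g : α → ℝ}
    (hw : ∀ x, 0 ≤ w x) (hwi : Integrable w μ) (hg : Integrable (fun x => w x * g x) μ)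
    (hg2 : Integrable (fun x => w x * g x ^ 2) μ) :
    (∫ x, w x * g x ∂μ) ^ 2 ≤ (∫ x, w x ∂μ) * ∫ x, w x * g x ^ 2 ∂μ := by
  have key : ∀ c : ℝ, 0 ≤ (∫ x, w x * g x ^ 2 ∂μ) - 2 * c * (∫ x, w x * g x ∂μ) +
      c ^ 2 * ∫ x, w x ∂μ := by
    intro c
    have hsub : Integrable (fun x => w x * g x ^ 2 - 2 * c * (w x * g x)) μ :=
      hg2.sub (hg.const_mul _)
    rw [← integral_const_mul, ← integral_const_mul, ← integral_sub hg2 (hg.const_mul _),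
      ← integral_add hsub (hwi.const_mul _)]
    refine integral_nonneg fun x => ?_
    have : w x * g x ^ 2 - 2 * c * (w x * g x) + c ^ 2 * w x = w x * (g x - c) ^ 2 := by ring
    simp only [Pi.zero_apply, this]
    exact mul_nonneg (hw x) (sq_nonneg _)
  have hdisc := discrim_le_zero (a := ∫ x, w x ∂μ) (b := -2 * ∫ x, w x * g x ∂μ)
    (c := ∫ x, w x * g x ^ 2 ∂μ) fun c => by linarith [key c]
  rw [discrim] at hdisc
  linarith

lemma cauchy_le_one (r : ℝ) : (1 + r ^ 2)⁻¹ ≤ 1 :=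
  inv_le_one_of_one_le₀ (by nlinarith [sq_nonneg r])

lemma continuous_cauchy_sub_div {n : ℕ} (i : Fin n) (L : ℝ) :
    Continuous fun w : ℝ × (Fin n → ℝ) =>
      2560016 * (1 + ((w.1 - w.2 i) / L) ^ 2)⁻¹ := by
  refine continuous_const.mul (Continuous.inv₀ (by fun_prop) fun w => ?_)
  positivity

lemma integrable_norm_mul_sqrt_cauchy {n : ℕ} {u : (Fin n → ℝ) → ℂ} (hu : Integrable u)
    (i : Fin n) (a L : ℝ) :
    Integrable fun z => ‖u z‖ * √(2560016 * (1 + ((a - z i) / L) ^ 2)⁻¹) := by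
  have hc : Continuous fun z : Fin n → ℝ => √(2560016 * (1 + ((a - z i) / L) ^ 2)⁻¹) :=
    ((continuous_cauchy_sub_div i L).comp (Continuous.prodMk_right a)).sqrt
  refine hu.norm.mul_bdd (c := √2560016) hc.aestronglyMeasurable
    (Filter.Eventually.of_forall fun z => ?_)
  rw [Real.norm_of_nonneg (Real.sqrt_nonneg _)]
  exact Real.sqrt_le_sqrt (by linarith [cauchy_le_one ((a - z i) / L)])

lemma sq_integral_norm_mul_sqrt_le {n : ℕ} {u : (Fin n → ℝ) → ℂ} (hu : Integrable u)
    (i : Fin n) (a : ℝ) {L : ℝ} :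
    (∫ z, ‖u z‖ * √(2560016 * (1 + ((a - z i) / L) ^ 2)⁻¹)) ^ 2 ≤
      (∫ z, ‖u z‖) * ∫ z, ‖u z‖ * (2560016 * (1 + ((a - z i) / L) ^ 2)⁻¹) := by
  have hsq : ∀ z : Fin n → ℝ, √(2560016 * (1 + ((a - z i) / L) ^ 2)⁻¹) ^ 2 =
      2560016 * (1 + ((a - z i) / L) ^ 2)⁻¹ := fun z => Real.sq_sqrt (by positivity)
  have hc : Continuous fun z : Fin n → ℝ => 2560016 * (1 + ((a - z i) / L) ^ 2)⁻¹ :=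
    (continuous_cauchy_sub_div i L).comp (Continuous.prodMk_right a)
  have hint : Integrable fun z => ‖u z‖ * (2560016 * (1 + ((a - z i) / L) ^ 2)⁻¹) := by
    refine hu.norm.mul_bdd (c := 2560016) hc.aestronglyMeasurable
      (Filter.Eventually.of_forall fun z => ?_)
    rw [Real.norm_of_nonneg (by positivity)]
    linarith [cauchy_le_one ((a - z i) / L)]
  have := sq_integral_mul_le (fun z => norm_nonneg (u z)) hu.norm
    (integrable_norm_mul_sqrt_cauchy hu i a L) (by simpa only [hsq] using hint)
  simpa only [hsq] using this

lemma integrable_cauchy_sub_div (b : ℝ) {L : ℝ} (hL : 0 < L) :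
    Integrable fun a : ℝ => (1 + ((a - b) / L) ^ 2)⁻¹ :=
  (integrable_inv_one_add_sq.comp_div hL.ne').comp_sub_right b

lemma integral_cauchy_sub_div (b : ℝ) {L : ℝ} (hL : 0 < L) :
    ∫ a : ℝ, (1 + ((a - b) / L) ^ 2)⁻¹ = Real.pi * L := by
  rw [integral_sub_right_eq_self (fun a : ℝ => (1 + (a / L) ^ 2)⁻¹) b,
    Measure.integral_comp_div (fun a : ℝ => (1 + a ^ 2)⁻¹) L, integral_univ_inv_one_add_sq,
    abs_of_pos hL, smul_eq_mul, mul_comm]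

lemma integrable_norm_mul_cauchy {n : ℕ} {u : (Fin n → ℝ) → ℂ} (hu : Integrable u)
    (i : Fin n) {L : ℝ} (hL : 0 < L) :
    Integrable (fun w : ℝ × (Fin n → ℝ) =>
      ‖u w.2‖ * (2560016 * (1 + ((w.1 - w.2 i) / L) ^ 2)⁻¹)) (volume.prod volume) := by
  have hm : AEStronglyMeasurable (fun w : ℝ × (Fin n → ℝ) =>
      ‖u w.2‖ * (2560016 * (1 + ((w.1 - w.2 i) / L) ^ 2)⁻¹)) (volume.prod volume) :=
    hu.norm.aestronglyMeasurable.comp_snd.mul (continuous_cauchy_sub_div i L).aestronglyMeasurable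
  rw [integrable_prod_iff' hm]
  refine ⟨Filter.Eventually.of_forall fun z =>
    ((integrable_cauchy_sub_div (z i) hL).const_mul 2560016).const_mul ‖u z‖, ?_⟩
  have : ∀ z : Fin n → ℝ, ∫ a : ℝ, ‖‖u z‖ * (2560016 * (1 + ((a - z i) / L) ^ 2)⁻¹)‖ =
      ‖u z‖ * (2560016 * (Real.pi * L)) := fun z => by
    rw [← integral_cauchy_sub_div (z i) hL, ← integral_const_mul, ← integral_const_mul]
    congr 1
    ext a
    exact Real.norm_of_nonneg (by positivity)
  simp only [this]
  exact hu.norm.mul_const _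

lemma integral_integral_norm_mul_cauchy {n : ℕ} {u : (Fin n → ℝ) → ℂ} (hu : Integrable u)
    (i : Fin n) {L : ℝ} (hL : 0 < L) :
    ∫ a : ℝ, ∫ z, ‖u z‖ * (2560016 * (1 + ((a - z i) / L) ^ 2)⁻¹) =
      2560016 * (Real.pi * L) * ∫ z, ‖u z‖ := by
  rw [integral_integral_swap (integrable_norm_mul_cauchy hu i hL)]
  simp only [integral_const_mul, integral_cauchy_sub_div _ hL, integral_mul_const]
  ring

lemma norm_Gnu_embed_le {ν t : ℝ} (hν : 0 ≤ ν) (ht : 0 ≤ t) (k : Fin 2 → ℤ)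
    {u : (Fin 2 → ℝ) → ℂ} (hu : Integrable u)
    (hsupp : ∀ ξ : Fin 2 → ℝ, (∃ j, 1 < |ξ j - (k j : ℝ)|) → FT u ξ = 0) (i : Fin 2) (a : ℝ)
    (y : {j : Fin 2 // j ≠ i} → ℝ) :
    ‖Gnu ν u t (embed i a y)‖ ≤
      ∫ z, ‖u z‖ * √(2560016 * (1 + ((a - z i) / (1 + |(k i : ℝ)|)) ^ 2)⁻¹) := by
  have hpi : ((2 * Real.pi) ^ 2)⁻¹ ≤ 1 := inv_le_one_of_one_le₀ (by nlinarith [Real.pi_gt_three])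
  rw [Gnu_eq_integral_oscKernel hν ht k hu hsupp, norm_smul, Real.norm_of_nonneg (by positivity)]
  refine (mul_le_of_le_one_left (norm_nonneg _) hpi).trans ?_
  refine norm_integral_le_of_norm_le (integrable_norm_mul_sqrt_cauchy hu i a _)
    (Filter.Eventually.of_forall fun z => ?_)
  have hprod : ∀ f : Fin 2 → ℂ, ∏ j, f j = f i * f i.rev := fun f => by
    fin_cases i <;> simp [Fin.prod_univ_two, mul_comm]
  have hi : embed i a y i = a := by simp [embed]
  rw [norm_mul, mul_comm, hprod, norm_mul, hi]
  exact mul_le_mul_of_nonneg_left (Real.le_sqrt_of_sq_le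
    (norm_oscKernel_mul_sq_le _ _ _ _ (mul_nonneg hν ht) ht)) (norm_nonneg _)

/-- two-dimensional maximal function estimate
`‖G_ν(t)u₀‖_{L²_{x_i} L^∞_{x_j (j≠i)} L^∞_{0≤t≤T}} ≤ C (1+|k_i|)^{1/2} ‖u₀‖_{L¹(ℝ²)}`,
uniform in `ν ≥ 0` and `T > 0`, for `u₀ ∈ L¹(ℝ²)` with `𝓕u₀` supported in the unit
cube around `k ∈ ℤ²`. -/
theorem stmt_14 (i : Fin 2) :
    ∃ C : ℝ, 0 < C ∧
      ∀ (ν : ℝ), 0 ≤ ν → ∀ (T : ℝ), 0 < T →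
      ∀ (k : Fin 2 → ℤ),
      ∀ u₀ : (Fin 2 → ℝ) → ℂ,
        Integrable u₀ →
        (∀ ξ : Fin 2 → ℝ, (∃ j, 1 < |ξ j - (k j : ℝ)|) → FT u₀ ξ = 0) →
        (∫ a : ℝ,
            (⨆ (t : ℝ) (_ : t ∈ Set.Icc (0 : ℝ) T) (y : {j : Fin 2 // j ≠ i} → ℝ),
                ‖Gnu ν u₀ t (embed i a y)‖) ^ 2) ^ ((1 : ℝ) / 2)
          ≤ C * (1 + |(k i : ℝ)|) ^ ((1 : ℝ) / 2) * ∫ y : Fin 2 → ℝ, ‖u₀ y‖ := by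
  refine ⟨√(2560016 * Real.pi), by positivity, fun ν hν T _ k u hu hsupp => ?_⟩
  have hU : 0 ≤ ∫ y, ‖u y‖ := integral_nonneg fun _ => norm_nonneg _
  have hL : 0 < 1 + |(k i : ℝ)| := by positivity
  have hmain : (∫ a : ℝ, (⨆ (t : ℝ) (_ : t ∈ Set.Icc (0 : ℝ) T) (y : {j : Fin 2 // j ≠ i} → ℝ),
      ‖Gnu ν u t (embed i a y)‖) ^ 2) ≤
      (∫ y, ‖u y‖) * ((2560016 * (Real.pi * (1 + |(k i : ℝ)|))) * ∫ y, ‖u y‖) := by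
    rw [← integral_integral_norm_mul_cauchy hu i hL, ← integral_const_mul]
    refine integral_mono_of_nonneg (Filter.Eventually.of_forall fun a => sq_nonneg _)
      ((integrable_norm_mul_cauchy hu i hL).integral_prod_left.const_mul _)
      (Filter.Eventually.of_forall fun a => ?_)
    refine le_trans ?_ (sq_integral_norm_mul_sqrt_le hu i a)
    refine pow_le_pow_left₀ (Real.iSup_nonneg fun t => Real.iSup_nonneg fun _ =>
      Real.iSup_nonneg fun y => norm_nonneg _) ?_ 2
    have h0 : 0 ≤ ∫ z, ‖u z‖ * √(2560016 * (1 + ((a - z i) / (1 + |(k i : ℝ)|)) ^ 2)⁻¹) :=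
      integral_nonneg fun z => by positivity
    exact Real.iSup_le (fun t => Real.iSup_le (fun ht => Real.iSup_le
      (fun y => norm_Gnu_embed_le hν ht.1 k hu hsupp i a y) h0) h0) h0
  rw [← Real.sqrt_eq_rpow, ← Real.sqrt_eq_rpow]
  calc _ ≤ √((∫ y, ‖u y‖) * ((2560016 * (Real.pi * (1 + |(k i : ℝ)|))) * ∫ y, ‖u y‖)) :=
        Real.sqrt_le_sqrt hmain
    _ = √((2560016 * Real.pi) * (1 + |(k i : ℝ)|) * (∫ y, ‖u y‖) ^ 2) := by
        congr 1
        ring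
    _ = _ := by
        rw [Real.sqrt_mul (by positivity), Real.sqrt_mul (by positivity), Real.sqrt_sq hU]
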